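/- ∫_0^{π/2} x^3 ln(cos(x)) dx = (93/128)ζ(5) − (9/8)ζ(2)ζ(3) − (45/32) ln(2) ζ(4). -/

import Mathlib

open Real

/-- Riemann zeta value at a positive integer `m > 1`, as the series `∑ 1/n^m`. -/
noncomputable def zetaVal (m : ℕ) : ℝ := ∑' n : ℕ, 1 / (n + 1 : ℝ) ^ m

/-- Polylogarithm `Li_m(z) = ∑_{k≥1} z^k / k^m`. -/
noncomputable def polyLog (m : ℕ) (z : ℝ) : ℝ := ∑' k : ℕ, z ^ (k + 1) / (k + 1 : ℝ) ^ m

/-- Generalized harmonic number `H_k^{(m)} = ∑_{n=1}^k 1/n^m`. -/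
noncomputable def genHarmonic (k m : ℕ) : ℝ := ∑ n ∈ Finset.range k, 1 / (n + 1 : ℝ) ^ m

open MeasureTheory Filter Topology

lemma aux_congr {f g : ℕ → ℝ} {a b : ℝ} (h : HasSum g b) (hab : a = b) (hfg : ∀ n, f n = g n) :
    HasSum f a := by
  rw [funext hfg, hab]
  exact h

lemma aux_J (n : ℕ) (hn : n ≠ 0) :
    ∫ x in (0 : ℝ)..(π / 2), x ^ 3 * Real.cos (2 * n * x)
      = 3 * π ^ 2 / 16 * (-1) ^ n / n ^ 2 + 3 / 8 * (1 - (-1) ^ n) / n ^ 4 := by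
  have hn' : (n : ℝ) ≠ 0 := by exact_mod_cast hn
  have key : ∀ x ∈ Set.uIcc (0:ℝ) (π/2), HasDerivAt (fun x : ℝ =>
      x ^ 3 * Real.sin (2 * n * x) / (2 * n) + 3 * x ^ 2 * Real.cos (2 * n * x) / (2 * n) ^ 2
      - 6 * x * Real.sin (2 * n * x) / (2 * n) ^ 3 - 6 * Real.cos (2 * n * x) / (2 * n) ^ 4)
      (x ^ 3 * Real.cos (2 * n * x)) x := by
    intro x _
    have hl : HasDerivAt (fun x : ℝ => 2 * (n : ℝ) * x) (2 * n) x := by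
      simpa using (hasDerivAt_id x).const_mul (2 * (n : ℝ))
    have hs := hl.sin
    have hc := hl.cos
    have h3 := hasDerivAt_pow 3 x
    have h2 := (hasDerivAt_pow 2 x).const_mul 3
    have h1 := (hasDerivAt_id x).const_mul 6
    refine HasDerivAt.congr_deriv (((((h3.mul hs).div_const (2 * n)).add ((h2.mul hc).div_const ((2 * n) ^ 2))).sub
      ((h1.mul hs).div_const ((2 * n) ^ 3))).sub ((hc.const_mul 6).div_const ((2 * n) ^ 4))) ?_
    simp only [id]
    push_cast
    field_simp
    ring
  rw [intervalIntegral.integral_eq_sub_of_hasDerivAt key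
    (Continuous.intervalIntegrable (by fun_prop) _ _)]
  have e : 2 * (n : ℝ) * (π / 2) = n * π := by ring
  simp only [e, Real.sin_nat_mul_pi, Real.cos_nat_mul_pi]
  simp
  field_simp
  ring

lemma aux_sum (r x : ℝ) (h0 : 0 ≤ r) (h1 : r < 1) :
    HasSum (fun n : ℕ => -((-r) ^ n / n) * Real.cos (2 * n * x))
      (Real.log ‖(1 : ℂ) + r * Complex.exp (2 * x * Complex.I)‖) := by
  have hz : ‖-(r * Complex.exp (2 * x * Complex.I))‖ < 1 := by
    have := Complex.norm_exp_ofReal_mul_I (2 * x)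
    push_cast at this
    rw [norm_neg, norm_mul, this]
    simpa [abs_of_nonneg h0] using h1
  have h := Complex.hasSum_re (Complex.hasSum_taylorSeries_neg_log hz)
  have h := h.neg
  rw [Complex.neg_re, neg_neg, Complex.log_re, sub_neg_eq_add] at h
  refine aux_congr h rfl fun n => ?_
  have : (-(r * Complex.exp (2 * x * Complex.I))) ^ n / (n : ℂ)
      = (((-r) ^ n / n : ℝ) : ℂ) * Complex.exp ((2 * n * x : ℝ) * Complex.I) := by
    rw [← neg_mul, mul_pow, ← Complex.exp_nat_mul]
    push_cast
    rw [show (n : ℂ) * (2 * x * Complex.I) = 2 * n * x * Complex.I by ring]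
    ring
  rw [this, Complex.re_ofReal_mul, Complex.exp_ofReal_mul_I_re]
  ring

lemma aux_int (r : ℝ) (h0 : 0 ≤ r) (h1 : r < 1) :
    HasSum (fun n : ℕ => r ^ n * (-(3 * π ^ 2 / 16) * (1 / (n : ℝ) ^ 3)
        + 3 / 8 * ((1 - (-1) ^ n) * (1 / (n : ℝ) ^ 5))))
      (∫ x in (0 : ℝ)..(π / 2), x ^ 3 *
        Real.log ‖(1 : ℂ) + r * Complex.exp (2 * x * Complex.I)‖) := by
  have h := intervalIntegral.hasSum_integral_of_dominated_convergence (μ := volume)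
    (a := 0) (b := π / 2)
    (F := fun (n : ℕ) x => x ^ 3 * (-((-r) ^ n / n) * Real.cos (2 * n * x)))
    (f := fun x => x ^ 3 * Real.log ‖(1 : ℂ) + r * Complex.exp (2 * x * Complex.I)‖)
    (fun n _ => (π / 2) ^ 3 * r ^ n)
    (fun n => (by fun_prop : Continuous _).aestronglyMeasurable)
    (fun n => ae_of_all _ fun x hx => ?_)
    (ae_of_all _ fun x _ => (summable_geometric_of_lt_one h0 h1).mul_left _)
    (by simp)
    (ae_of_all _ fun x _ => (aux_sum r x h0 h1).mul_left _)
  · refine aux_congr h rfl fun n => ?_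
    rcases eq_or_ne n 0 with rfl | hn
    · simp
    · have hn' : (n : ℝ) ≠ 0 := by exact_mod_cast hn
      have : ∀ x : ℝ, x ^ 3 * (-((-r) ^ n / n) * Real.cos (2 * n * x))
        = (-((-r) ^ n / n)) * (x ^ 3 * Real.cos (2 * n * x)) := fun x => by ring
      simp only [this]
      rw [intervalIntegral.integral_const_mul, aux_J n hn, neg_pow r n]
      have hsq : ((-1 : ℝ) ^ n) * (-1) ^ n = 1 := by rw [← mul_pow]; simp
      field_simp
      linear_combination (8 * π ^ 2 * (n:ℝ)^2 - 16) * r ^ n * hsq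
  · rw [Set.uIoc_of_le (by positivity)] at hx
    rw [norm_mul, norm_mul, norm_neg, norm_div, norm_pow, norm_pow, norm_neg]
    simp only [Real.norm_eq_abs, abs_of_nonneg h0, abs_of_pos hx.1]
    have hc := Real.abs_cos_le_one (2 * n * x)
    have hd : r ^ n / |(n : ℝ)| ≤ r ^ n := by
      rcases eq_or_ne n 0 with rfl | hn
      · simp
      · rw [Nat.abs_cast]
        exact div_le_self (by positivity) (by exact_mod_cast Nat.one_le_iff_ne_zero.mpr hn)
    have := hx.2
    have := hx.1.le
    calc x ^ 3 * (r ^ n / |(n : ℝ)| * |Real.cos (2 * n * x)|)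
        ≤ (π / 2) ^ 3 * (r ^ n * 1) := by gcongr
      _ = _ := by ring

lemma aux_summ : HasSum (fun n : ℕ => (-(3 * π ^ 2 / 16) * (1 / (n : ℝ) ^ 3)
        + 3 / 8 * ((1 - (-1) ^ n) * (1 / (n : ℝ) ^ 5))))
      (-(3 * π ^ 2 / 16) * zetaVal 3 + 3 / 8 * (31 / 16 * zetaVal 5)) := by
  have hz : ∀ m : ℕ, 1 < m → HasSum (fun n : ℕ => 1 / (n : ℝ) ^ m) (zetaVal m) := by
    intro m hm
    have hs := Real.summable_one_div_nat_pow.mpr hm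
    have := hs.hasSum
    rw [hs.tsum_eq_zero_add] at this
    have hm0 : m ≠ 0 := by omega
    simpa [zetaVal, hm0] using this
  have h3 := hz 3 (by norm_num)
  have h5 := hz 5 (by norm_num)
  have he : HasSum (fun n : ℕ => (1 + (-1 : ℝ) ^ n) * (1 / (n : ℝ) ^ 5)) (1 / 16 * zetaVal 5 + 0) := by
    apply HasSum.even_add_odd
    · refine aux_congr (h5.mul_left (1 / 16)) rfl fun n => ?_
      rw [pow_mul]
      push_cast
      rw [mul_pow]
      norm_num
      ring
    · refine aux_congr hasSum_zero rfl fun n => ?_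
      rw [pow_succ, pow_mul]
      norm_num
  refine HasSum.add (h3.mul_left _) (HasSum.mul_left _ ?_)
  refine aux_congr ((h5.mul_left 2).sub he) (by ring) fun n => ?_
  ring

lemma aux_norm_sq (r x : ℝ) : ‖(1 : ℂ) + r * Complex.exp (2 * x * Complex.I)‖ ^ 2
    = (r + Real.cos (2 * x)) ^ 2 + Real.sin (2 * x) ^ 2 := by
  have : (2 * x * Complex.I : ℂ) = ((2 * x : ℝ) : ℂ) * Complex.I := by push_cast; ring
  rw [this, ← Complex.normSq_eq_norm_sq, Complex.normSq_apply]
  simp only [Complex.add_re, Complex.add_im, Complex.re_ofReal_mul, Complex.im_ofReal_mul,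
    Complex.exp_ofReal_mul_I_re, Complex.exp_ofReal_mul_I_im, Complex.one_re, Complex.one_im]
  linear_combination (r ^ 2 - 1) * Real.sin_sq_add_cos_sq (2 * x)

lemma aux_norm_one (x : ℝ) : ‖(1 : ℂ) + (1 : ℝ) * Complex.exp (2 * x * Complex.I)‖
    = 2 * |Real.cos x| := by
  rw [← sq_eq_sq₀ (by positivity) (by positivity), aux_norm_sq, mul_pow, sq_abs,
    Real.cos_two_mul, Real.sin_two_mul]
  linear_combination 4 * Real.cos x ^ 2 * Real.sin_sq_add_cos_sq x

lemma aux_lim : Tendsto (fun r : ℝ => ∫ x in (0 : ℝ)..(π / 2), x ^ 3 *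
        Real.log ‖(1 : ℂ) + r * Complex.exp (2 * x * Complex.I)‖) (𝓝[<] 1)
      (𝓝 (∫ x in (0 : ℝ)..(π / 2), x ^ 3 *
        Real.log ‖(1 : ℂ) + (1 : ℝ) * Complex.exp (2 * x * Complex.I)‖)) := by
  have hne : ∀ᵐ x : ℝ, x ≠ π / 2 := by simp [ae_iff]
  have hr : ∀ᶠ r : ℝ in 𝓝[<] 1, 0 < r ∧ r < 1 := by
    filter_upwards [Ioo_mem_nhdsLT (zero_lt_one' ℝ)] with r hr using hr
  have hpos : ∀ x : ℝ, x ≠ π / 2 → x ∈ Set.uIoc 0 (π / 2) → 0 < Real.sin (2 * x) := by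
    intro x hx hx'
    rw [Set.uIoc_of_le (by positivity)] at hx'
    have := lt_of_le_of_ne hx'.2 hx
    exact Real.sin_pos_of_pos_of_lt_pi (by linarith [hx'.1]) (by linarith)
  apply intervalIntegral.tendsto_integral_filter_of_dominated_convergence
    (fun x => (π / 2) ^ 3 * (Real.log 2 - Real.log (Real.sin (2 * x))))
  · refine Eventually.of_forall fun r => Measurable.aestronglyMeasurable ?_
    fun_prop
  · filter_upwards [hr] with r hr
    filter_upwards [hne] with x hx hx'
    have hs := hpos x hx hx'
    have hsq := aux_norm_sq r x
    set N := ‖(1 : ℂ) + r * Complex.exp (2 * x * Complex.I)‖ with hN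
    have hN0 : 0 ≤ N := norm_nonneg _
    have hlow : Real.sin (2 * x) ≤ N := by
      refine (sq_le_sq₀ hs.le hN0).mp ?_
      nlinarith [sq_nonneg (r + Real.cos (2 * x))]
    have hup : N ≤ 2 := by
      refine (sq_le_sq₀ hN0 (by norm_num)).mp ?_
      nlinarith [Real.sin_sq_add_cos_sq (2 * x), Real.cos_le_one (2 * x)]
    have l1 := Real.log_le_log hs hlow
    have l2 := Real.log_le_log (hs.trans_le hlow) hup
    have l3 : Real.log (Real.sin (2 * x)) ≤ 0 :=
      Real.log_nonpos hs.le (Real.sin_le_one _)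
    have l4 : 0 ≤ Real.log 2 := Real.log_nonneg (by norm_num)
    rw [Set.uIoc_of_le (by positivity)] at hx'
    have := hx'.1.le
    have := hx'.2
    rw [norm_mul, norm_pow, Real.norm_eq_abs, Real.norm_eq_abs, abs_of_pos hx'.1]
    have : |Real.log N| ≤ Real.log 2 - Real.log (Real.sin (2 * x)) := by
      rw [abs_le]; constructor <;> linarith
    gcongr
  · apply IntervalIntegrable.const_mul
    apply IntervalIntegrable.sub (by simp)
    have := (intervalIntegrable_log_sin (a := 0) (b := π)).comp_mul_left (c := 2)
    simpa using this
  · filter_upwards [hne] with x hx hx'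
    have hs := hpos x hx hx'
    have hsq := aux_norm_sq 1 x
    have hN : ‖(1 : ℂ) + (1 : ℝ) * Complex.exp (2 * x * Complex.I)‖ ≠ 0 := by
      intro h0
      rw [h0] at hsq
      nlinarith [sq_nonneg (1 + Real.cos (2 * x))]
    have hc : ContinuousAt (fun r : ℝ => x ^ 3 *
        Real.log ‖(1 : ℂ) + r * Complex.exp (2 * x * Complex.I)‖) 1 := by
      refine continuousAt_const.mul (ContinuousAt.log ?_ hN)
      exact (by fun_prop : Continuous fun r : ℝ =>
        ‖(1 : ℂ) + r * Complex.exp (2 * x * Complex.I)‖).continuousAt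
    exact hc.tendsto.mono_left nhdsWithin_le_nhds

lemma aux_lim2 : Tendsto (fun r : ℝ => ∑' n : ℕ, r ^ n * (-(3 * π ^ 2 / 16) * (1 / (n : ℝ) ^ 3)
        + 3 / 8 * ((1 - (-1) ^ n) * (1 / (n : ℝ) ^ 5)))) (𝓝[<] 1)
      (𝓝 (-(3 * π ^ 2 / 16) * zetaVal 3 + 3 / 8 * (31 / 16 * zetaVal 5))) := by
  rw [← aux_summ.tsum_eq]
  apply tendsto_tsum_of_dominated_convergence aux_summ.summable.norm
  · intro n
    have : ContinuousAt (fun r : ℝ => r ^ n * (-(3 * π ^ 2 / 16) * (1 / (n : ℝ) ^ 3)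
        + 3 / 8 * ((1 - (-1) ^ n) * (1 / (n : ℝ) ^ 5)))) 1 :=
      ((continuous_pow n).mul continuous_const).continuousAt
    have := this.tendsto.mono_left (nhdsWithin_le_nhds (s := Set.Iio 1))
    simpa only [one_pow, one_mul] using this
  · filter_upwards [Ioo_mem_nhdsLT (zero_lt_one' ℝ)] with r hr n
    rw [norm_mul, norm_pow, Real.norm_eq_abs r, abs_of_pos hr.1]
    exact mul_le_of_le_one_left (norm_nonneg _) (pow_le_one₀ hr.1.le hr.2.le)

theorem stmt_19 :
    ∫ x in (0 : ℝ)..(π / 2), x ^ 3 * Real.log (Real.cos x)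
    = 93 / 128 * zetaVal 5 - 9 / 8 * zetaVal 2 * zetaVal 3 - 45 / 32 * Real.log 2 * zetaVal 4 := by
  have h2 : zetaVal 2 = π ^ 2 / 6 := by
    have := hasSum_zeta_two.tsum_eq
    rw [hasSum_zeta_two.summable.tsum_eq_zero_add] at this
    simpa [zetaVal] using this
  have h4 : zetaVal 4 = π ^ 4 / 90 := by
    have := hasSum_zeta_four.tsum_eq
    rw [hasSum_zeta_four.summable.tsum_eq_zero_add] at this
    simpa [zetaVal] using this
  have hlim : Tendsto (fun r : ℝ => ∫ x in (0 : ℝ)..(π / 2), x ^ 3 *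
        Real.log ‖(1 : ℂ) + r * Complex.exp (2 * x * Complex.I)‖) (𝓝[<] 1)
      (𝓝 (-(3 * π ^ 2 / 16) * zetaVal 3 + 3 / 8 * (31 / 16 * zetaVal 5))) := by
    refine aux_lim2.congr' ?_
    filter_upwards [Ioo_mem_nhdsLT (zero_lt_one' ℝ)] with r hr
    exact (aux_int r hr.1.le hr.2).tsum_eq
  have hu := tendsto_nhds_unique aux_lim hlim
  have hne : ∀ᵐ x : ℝ, x ≠ π / 2 := by simp [ae_iff]
  have hint : IntervalIntegrable (fun x => x ^ 3 * Real.log (Real.cos x)) volume 0 (π / 2) :=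
    (intervalIntegrable_log_cos (a := 0) (b := π / 2)).continuousOn_mul
      (f := fun x => Real.log (Real.cos x)) (g := fun x => x ^ 3) (by fun_prop)
  have hcongr : ∫ x in (0 : ℝ)..(π / 2), x ^ 3 *
        Real.log ‖(1 : ℂ) + (1 : ℝ) * Complex.exp (2 * x * Complex.I)‖
      = ∫ x in (0 : ℝ)..(π / 2), (x ^ 3 * Real.log 2 + x ^ 3 * Real.log (Real.cos x)) := by
    apply intervalIntegral.integral_congr_ae
    filter_upwards [hne] with x hx hx'
    rw [Set.uIoc_of_le (by positivity)] at hx'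
    have := lt_of_le_of_ne hx'.2 hx
    have hc : 0 < Real.cos x := Real.cos_pos_of_mem_Ioo ⟨by linarith [hx'.1, Real.pi_pos], this⟩
    rw [aux_norm_one, abs_of_pos hc, Real.log_mul (by norm_num) hc.ne']
    ring
  rw [hcongr, intervalIntegral.integral_add (Continuous.intervalIntegrable (by fun_prop) _ _) hint,
    intervalIntegral.integral_mul_const, integral_pow] at hu
  rw [h2, h4]
  norm_num at hu
  linear_combination hu
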